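/- Let G be the star graph with n leaves (vertex set {0,1,…,n}, edges {0j} for j=1,…,n), with unit weights. Then the optimal value of the Lasserre₂ relaxation of Quantum Max Cut on G, namely the supremum over Lasserre₂-feasible matrices M of Σ_{j=1}^n (1 − M(X₀X_j, I) − M(Y₀Y_j, I) − M(Z₀Z_j, I)), equals 2(n+1). -/

import Mathlib

open Matrix

/-- The 2×2 Pauli matrices `I, X, Y, Z`, indexed by `Fin 4` (with `0 ↦ I`). -/
noncomputable def pauli : Fin 4 → Matrix (Fin 2) (Fin 2) ℂ
  | 0 => 1
  | 1 => !![0, 1; 1, 0]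
  | 2 => !![0, -Complex.I; Complex.I, 0]
  | 3 => !![1, 0; 0, -1]

/-- A Pauli word on `n` qubits: a choice of `I, X, Y` or `Z` for each qubit. -/
abbrev PauliWord (n : ℕ) := Fin n → Fin 4

/-- The matrix of a Pauli word: the `n`-fold Kronecker product of its letters, realized
on `ℂ^{2^n}` identified with functions `Fin n → Fin 2`, so the entries are products of
entries of the 2×2 factors. -/
noncomputable def wordMat {n : ℕ} (w : PauliWord n) :
    Matrix (Fin n → Fin 2) (Fin n → Fin 2) ℂ :=
  Matrix.of fun f g => ∏ k, pauli (w k) (f k) (g k)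

/-- The weight of a Pauli word: the number of non-identity letters. -/
def wordWeight {n : ℕ} (w : PauliWord n) : ℕ :=
  (Finset.univ.filter fun k => w k ≠ 0).card

/-- `P_n(2)`: Pauli words on `n` qubits with at most 2 non-identity factors. -/
abbrev PauliWord2 (n : ℕ) := {w : PauliWord n // wordWeight w ≤ 2}

/-- The all-identity Pauli word, as an element of `P_n(2)`. -/
def idWord (n : ℕ) : PauliWord2 n := ⟨fun _ => 0, by simp [wordWeight]⟩

/-- The Pauli word `σ_i σ_j` with letter `σ` at positions `i` and `j` and identity
elsewhere, as an element of `P_n(2)`. -/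
def pairWord {n : ℕ} (σ : Fin 4) (i j : Fin n) : PauliWord2 n :=
  ⟨fun k => if k = i ∨ k = j then σ else 0, by
    classical
    unfold wordWeight
    have hsub : (Finset.univ.filter fun k =>
        (if k = i ∨ k = j then σ else (0 : Fin 4)) ≠ 0) ⊆ ({i, j} : Finset (Fin n)) := by
      intro k hk
      simp only [Finset.mem_filter, Finset.mem_univ, true_and] at hk
      simp only [Finset.mem_insert, Finset.mem_singleton]
      by_contra h
      push_neg at h
      exact hk (if_neg (by tauto))
    exact le_trans (Finset.card_le_card hsub)
      (by simpa using Finset.card_insert_le i ({j} : Finset (Fin n)))⟩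

/-- A real symmetric matrix `M` with rows and columns indexed by `P_n(2)` is
Lasserre₂-feasible if it is positive semidefinite, has unit diagonal, vanishes at pairs
whose Pauli product is not Hermitian, and respects equality (resp. negation) of Pauli
products. -/
def Lasserre2Feasible {n : ℕ} (M : Matrix (PauliWord2 n) (PauliWord2 n) ℝ) : Prop :=
  M.IsSymm ∧ M.PosSemidef ∧
  (∀ Γ, M Γ Γ = 1) ∧
  (∀ Γ Φ : PauliWord2 n, ¬(wordMat Γ.1 * wordMat Φ.1).IsHermitian → M Γ Φ = 0) ∧
  (∀ Γ Φ Γ' Φ' : PauliWord2 n,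
    wordMat Γ.1 * wordMat Φ.1 = wordMat Γ'.1 * wordMat Φ'.1 → M Γ Φ = M Γ' Φ') ∧
  (∀ Γ Φ Γ' Φ' : PauliWord2 n,
    wordMat Γ.1 * wordMat Φ.1 = -(wordMat Γ'.1 * wordMat Φ'.1) → M Γ Φ = -M Γ' Φ')

/-- The edge value `v_ij` from a Lasserre₂ moment matrix. -/
noncomputable def edgeVal {n : ℕ} (M : Matrix (PauliWord2 n) (PauliWord2 n) ℝ)
    (i j : Fin n) : ℝ :=
  (M (pairWord 1 i j) (idWord n) + M (pairWord 2 i j) (idWord n)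
    + M (pairWord 3 i j) (idWord n)) / 3

theorem pauli_zero : pauli 0 = 1 := rfl

theorem pauli_isHermitian (σ : Fin 4) : (pauli σ).IsHermitian := by
  fin_cases σ <;> ext i j <;> fin_cases i <;> fin_cases j <;> simp [pauli]

theorem pauli_mul_self (σ : Fin 4) : pauli σ * pauli σ = 1 := by
  fin_cases σ <;> ext i j <;> fin_cases i <;> fin_cases j <;> simp [pauli, Matrix.mul_apply]

/-- Any two Pauli matrices commute or anticommute. -/
theorem pauli_mul_comm_or (σ τ : Fin 4) :
    pauli σ * pauli τ = (if σ = 0 ∨ τ = 0 ∨ σ = τ then (1 : ℂ) else -1) • (pauli τ * pauli σ) := by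
  fin_cases σ <;> fin_cases τ <;> ext i j <;> fin_cases i <;> fin_cases j <;>
    simp [pauli, Matrix.mul_apply]

theorem wordMat_mul_apply {n : ℕ} (w u : PauliWord n) (f g : Fin n → Fin 2) :
    (wordMat w * wordMat u) f g = ∏ k, (pauli (w k) * pauli (u k)) (f k) (g k) := by
  simp only [wordMat, Matrix.mul_apply, Matrix.of_apply, ← Finset.prod_mul_distrib]
  rw [Finset.prod_univ_sum, Fintype.piFinset_univ]

/-- Proportionality of two products of Pauli words can be checked letter by letter. -/
theorem wordMat_mul_eq_smul {n : ℕ} {w u w' u' : PauliWord n} (c : Fin n → ℂ)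
    (h : ∀ k, pauli (w k) * pauli (u k) = c k • (pauli (w' k) * pauli (u' k))) :
    wordMat w * wordMat u = (∏ k, c k) • (wordMat w' * wordMat u') := by
  ext f g
  simp [wordMat_mul_apply, h, Finset.prod_mul_distrib]

theorem wordMat_isHermitian {n : ℕ} (w : PauliWord n) : (wordMat w).IsHermitian := by
  ext f g
  simp only [wordMat, Matrix.conjTranspose_apply, Matrix.of_apply, star_prod]
  exact Finset.prod_congr rfl fun k _ => (pauli_isHermitian (w k)).apply _ _

theorem wordMat_zero (n : ℕ) : wordMat (fun _ : Fin n => 0) = 1 := by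
  ext f g
  simp only [wordMat, pauli, Matrix.of_apply, Matrix.one_apply, Finset.prod_ite_zero,
    Finset.prod_const_one, Finset.mem_univ, true_imp_iff, funext_iff]

theorem wordMat_mul_self {n : ℕ} (w : PauliWord n) : wordMat w * wordMat w = 1 := by
  rw [wordMat_mul_eq_smul (w' := fun _ => 0) (u' := fun _ => 0) (fun _ => 1)
    (fun k => by simp [pauli_mul_self]), wordMat_zero]
  simp

/-- Any two Pauli words commute or anticommute. -/
theorem wordMat_mul_comm_or {n : ℕ} (w u : PauliWord n) :
    wordMat w * wordMat u = wordMat u * wordMat w ∨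
      wordMat w * wordMat u = -(wordMat u * wordMat w) := by
  have h := wordMat_mul_eq_smul _ fun k => pauli_mul_comm_or (w k) (u k)
  rw [Finset.prod_ite] at h
  rcases neg_one_pow_eq_or ℂ
    (Finset.univ.filter fun k => ¬(w k = 0 ∨ u k = 0 ∨ w k = u k)).card with h' | h' <;>
    simp_all

section UpperBound

variable {n : ℕ} {M : Matrix (PauliWord2 n) (PauliWord2 n) ℝ}

/-- The pseudo-expectation of `X_i X_j + Y_i Y_j + Z_i Z_j`. -/
noncomputable def pairSum (M : Matrix (PauliWord2 n) (PauliWord2 n) ℝ) (i j : Fin n) : ℝ :=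
  ∑ σ : Fin 3, M (pairWord σ.succ i j) (idWord n)

/-- Nonnegativity of the pseudo-variance of a sum of Pauli words. -/
theorem Lasserre2Feasible.sq_sum_le (hM : Lasserre2Feasible M) {ι : Type*} [Fintype ι]
    (p : ι → PauliWord2 n) :
    (∑ i, M (p i) (idWord n)) ^ 2 ≤ ∑ i, ∑ j, M (p i) (p j) := by
  have hsymm : ∀ Γ Φ, M Γ Φ = M Φ Γ := fun Γ Φ => hM.1.apply Φ Γ
  set t := ∑ i, M (p i) (idWord n) with ht
  have h := (hM.2.1.submatrix fun o : Option ι => o.elim (idWord n) p).dotProduct_mulVec_nonneg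
    fun o => o.elim (-t) fun _ => 1
  simp only [dotProduct, mulVec, Fintype.sum_option, Pi.star_apply, Option.elim,
    Matrix.submatrix_apply, star_trivial, hM.2.2.1, mul_one, one_mul, Finset.sum_add_distrib,
    ← Finset.sum_mul, hsymm (idWord n), ← ht] at h
  linarith

theorem Lasserre2Feasible.eq_of_letters (hM : Lasserre2Feasible M) {w u w' u' : PauliWord2 n}
    (h : ∀ k, pauli (w.1 k) * pauli (u.1 k) = pauli (w'.1 k) * pauli (u'.1 k)) :
    M w u = M w' u' :=
  hM.2.2.2.2.1 _ _ _ _ <| by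
    simpa using wordMat_mul_eq_smul (fun _ => 1) fun k => by simpa using h k

theorem Lasserre2Feasible.eq_neg_of_letters (hM : Lasserre2Feasible M)
    {w u w' u' : PauliWord2 n} (c : Fin n → ℂ) (hc : ∏ k, c k = -1)
    (h : ∀ k, pauli (w.1 k) * pauli (u.1 k) = c k • (pauli (w'.1 k) * pauli (u'.1 k))) :
    M w u = -M w' u' :=
  hM.2.2.2.2.2 _ _ _ _ <| by simpa [hc] using wordMat_mul_eq_smul c h

/-- The third non-identity Pauli letter `ρ`, and the phase `c`, in `σ τ = c ρ`. -/
theorem pauli_mul_of_ne {σ τ : Fin 3} (h : σ ≠ τ) : ∃ c : ℂ, c ^ 2 = -1 ∧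
    pauli σ.succ * pauli τ.succ = c • pauli (Fin.succ (-(σ + τ))) := by
  fin_cases σ <;> fin_cases τ <;> try exact absurd rfl h
  · refine ⟨Complex.I, by simp, ?_⟩
    change pauli 1 * pauli 2 = _ • pauli 3
    ext i j; fin_cases i <;> fin_cases j <;> simp [pauli]
  · refine ⟨-Complex.I, by simp, ?_⟩
    change pauli 1 * pauli 3 = _ • pauli 2
    ext i j; fin_cases i <;> fin_cases j <;> simp [pauli]
  · refine ⟨-Complex.I, by simp, ?_⟩
    change pauli 2 * pauli 1 = _ • pauli 3
    ext i j; fin_cases i <;> fin_cases j <;> simp [pauli]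
  · refine ⟨Complex.I, by simp, ?_⟩
    change pauli 2 * pauli 3 = _ • pauli 1
    ext i j; fin_cases i <;> fin_cases j <;> simp [pauli]
  · refine ⟨Complex.I, by simp, ?_⟩
    change pauli 3 * pauli 1 = _ • pauli 2
    ext i j; fin_cases i <;> fin_cases j <;> simp [pauli]
  · refine ⟨-Complex.I, by simp, ?_⟩
    change pauli 3 * pauli 2 = _ • pauli 1
    ext i j; fin_cases i <;> fin_cases j <;> simp [pauli]

theorem Lasserre2Feasible.pair_same_edge (hM : Lasserre2Feasible M) {i j : Fin n} (hij : i ≠ j)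
    (σ τ : Fin 3) : M (pairWord σ.succ i j) (pairWord τ.succ i j) =
      if σ = τ then 1 else -M (pairWord (Fin.succ (-(σ + τ))) i j) (idWord n) := by
  split_ifs with h
  · rw [h, hM.2.2.1]
  · obtain ⟨c, hc, hmul⟩ := pauli_mul_of_ne h
    refine hM.eq_neg_of_letters (fun k => if k = i ∨ k = j then c else 1) ?_ fun k => ?_
    · rw [Fintype.prod_eq_mul i j hij fun k hk => if_neg (by tauto)]
      simp [← hc, sq]
    · by_cases hk : k = i ∨ k = j <;> simp [-neg_add_rev, pairWord, idWord, hk, hmul, pauli_zero]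

theorem Lasserre2Feasible.sum_pair_same_edge (hM : Lasserre2Feasible M) {i j : Fin n}
    (hij : i ≠ j) : ∑ σ : Fin 3, ∑ τ : Fin 3, M (pairWord σ.succ i j) (pairWord τ.succ i j) =
      3 - 2 * pairSum M i j := by
  have e₀ : (-(1 + 2) : Fin 3) = 0 := by decide
  have e₁ : (-(0 + 2) : Fin 3) = 1 := by decide
  have e₂ : (-(0 + 1) : Fin 3) = 2 := by decide
  have h₀ : (0 : Fin 3) ≠ 1 := by decide
  have h₁ : (0 : Fin 3) ≠ 2 := by decide
  have h₂ : (1 : Fin 3) ≠ 2 := by decide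
  simp only [hM.pair_same_edge hij, pairSum, Fin.sum_univ_three, h₀, h₁, h₂, h₀.symm, h₁.symm,
    h₂.symm, if_true, if_false, add_comm (1 : Fin 3) 0, add_comm (2 : Fin 3) 0,
    add_comm (2 : Fin 3) 1, e₀, e₁, e₂]
  ring

theorem Lasserre2Feasible.pairSum_le_one (hM : Lasserre2Feasible M) {i j : Fin n}
    (hij : i ≠ j) : pairSum M i j ≤ 1 := by
  have h := hM.sq_sum_le fun σ : Fin 3 => pairWord σ.succ i j
  rw [hM.sum_pair_same_edge hij, ← pairSum] at h
  nlinarith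

theorem Lasserre2Feasible.pair_adjacent_edges (hM : Lasserre2Feasible M) {i j k : Fin n}
    (hij : i ≠ j) (hik : i ≠ k) (hjk : j ≠ k) (σ τ : Fin 3) :
    M (pairWord σ.succ i j) (pairWord τ.succ i k) =
      if σ = τ then M (pairWord σ.succ j k) (idWord n) else 0 := by
  split_ifs with h
  · subst h
    refine hM.eq_of_letters fun l => ?_
    rcases eq_or_ne l i with rfl | hi
    · simp [pairWord, idWord, hij, hik, pauli_mul_self, pauli_zero]
    rcases eq_or_ne l j with rfl | hj
    · simp [pairWord, idWord, hi, hjk, pauli_zero]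
    · simp [pairWord, idWord, hi, hj, pauli_zero]
  · have hanti : M (pairWord σ.succ i j) (pairWord τ.succ i k) =
        -M (pairWord τ.succ i k) (pairWord σ.succ i j) := by
      refine hM.eq_neg_of_letters (fun l => if l = i then -1 else 1) (by simp) fun l => ?_
      rcases eq_or_ne l i with rfl | hi
      · have := pauli_mul_comm_or σ.succ τ.succ
        simpa [pairWord, h] using this
      rcases eq_or_ne l j with rfl | hj
      · simp [pairWord, hi, hjk, pauli_zero]
      · simp [pairWord, hi, hj, pauli_zero]
    have hsymm := hM.1.apply (pairWord σ.succ i j) (pairWord τ.succ i k)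
    linarith

theorem Lasserre2Feasible.star_le {M : Matrix (PauliWord2 (n + 1)) (PauliWord2 (n + 1)) ℝ}
    (hM : Lasserre2Feasible M) :
    ∑ j : Fin n, (1 - pairSum M 0 j.succ) ≤ 2 * ((n : ℝ) + 1) := by
  set t := ∑ j : Fin n, pairSum M 0 j.succ with ht
  have h := hM.sq_sum_le fun p : Fin n × Fin 3 => pairWord p.2.succ 0 p.1.succ
  have hle : ∀ j k : Fin n, ∑ σ : Fin 3, ∑ τ : Fin 3,
      M (pairWord σ.succ 0 j.succ) (pairWord τ.succ 0 k.succ) ≤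
        1 + if j = k then 2 - 2 * pairSum M 0 j.succ else 0 := by
    intro j k
    split_ifs with hjk
    · subst hjk
      rw [hM.sum_pair_same_edge (Fin.succ_ne_zero j).symm]
      linarith
    · have hjk' : j.succ ≠ k.succ := fun h => hjk (Fin.succ_injective _ h)
      simp only [hM.pair_adjacent_edges (Fin.succ_ne_zero j).symm (Fin.succ_ne_zero k).symm hjk',
        Finset.sum_ite_eq, Finset.mem_univ, if_true]
      simpa [pairSum] using hM.pairSum_le_one hjk'
  have hsum := Finset.sum_le_sum fun j (_ : j ∈ Finset.univ) =>
    Finset.sum_le_sum fun k (_ : k ∈ Finset.univ) => hle j k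
  simp only [Fintype.sum_prod_type] at h
  simp only [Finset.sum_add_distrib, Finset.sum_ite_eq, Finset.mem_univ, if_true,
    Finset.sum_sub_distrib, ← Finset.mul_sum, ← ht, Finset.sum_const, Finset.card_univ,
    Fintype.card_fin, nsmul_eq_mul, mul_one] at hsum
  have hcomm : ∑ j : Fin n, ∑ σ : Fin 3, ∑ k : Fin n, ∑ τ : Fin 3,
      M (pairWord σ.succ 0 j.succ) (pairWord τ.succ 0 k.succ) =
      ∑ j : Fin n, ∑ k : Fin n, ∑ σ : Fin 3, ∑ τ : Fin 3,
      M (pairWord σ.succ 0 j.succ) (pairWord τ.succ 0 k.succ) :=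
    Finset.sum_congr rfl fun j _ => Finset.sum_comm
  rw [hcomm] at h
  change t ^ 2 ≤ _ at h
  have hn : (0 : ℝ) ≤ n := n.cast_nonneg
  simp only [Finset.sum_sub_distrib, ← ht, Finset.sum_const, Finset.card_univ,
    Fintype.card_fin, nsmul_eq_mul, mul_one]
  nlinarith

end UpperBound

section Attainment

/-- The real part of the moment matrix of a (not necessarily normalized) state `ψ`. -/
noncomputable def momentMatrix {n : ℕ} (ψ : (Fin n → Fin 2) → ℂ) :
    Matrix (PauliWord2 n) (PauliWord2 n) ℝ :=
  Matrix.of fun Γ Φ =>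
    (star ψ ⬝ᵥ ((wordMat Γ.1 * wordMat Φ.1) *ᵥ ψ)).re / (star ψ ⬝ᵥ ψ).re

theorem momentMatrix_apply_eq_sum {n : ℕ} (ψ : (Fin n → Fin 2) → ℂ) (Γ Φ : PauliWord2 n) :
    momentMatrix ψ Γ Φ = (∑ f, ((wordMat Γ.1 *ᵥ ψ) f).re * ((wordMat Φ.1 *ᵥ ψ) f).re +
      ∑ f, ((wordMat Γ.1 *ᵥ ψ) f).im * ((wordMat Φ.1 *ᵥ ψ) f).im) / (star ψ ⬝ᵥ ψ).re := by
  have h : star ψ ⬝ᵥ ((wordMat Γ.1 * wordMat Φ.1) *ᵥ ψ) =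
      star (wordMat Γ.1 *ᵥ ψ) ⬝ᵥ (wordMat Φ.1 *ᵥ ψ) := by
    rw [Matrix.star_mulVec, (wordMat_isHermitian Γ.1).eq, ← Matrix.mulVec_mulVec,
      Matrix.dotProduct_mulVec]
  rw [momentMatrix, Matrix.of_apply, h, ← Finset.sum_add_distrib]
  simp [dotProduct]

open scoped ComplexOrder in
theorem dotProduct_star_self_re_pos {ι : Type*} [Fintype ι] {ψ : ι → ℂ} (hψ : ψ ≠ 0) :
    0 < (star ψ ⬝ᵥ ψ).re :=
  (Complex.pos_iff.1 (Matrix.dotProduct_star_self_pos_iff.2 hψ)).1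

theorem momentMatrix_feasible {n : ℕ} {ψ : (Fin n → Fin 2) → ℂ} (hψ : ψ ≠ 0) :
    Lasserre2Feasible (momentMatrix ψ) := by
  have hpos := dotProduct_star_self_re_pos hψ
  have hsymm : ∀ Γ Φ, momentMatrix ψ Γ Φ = momentMatrix ψ Φ Γ := fun Γ Φ => by
    simp only [momentMatrix_apply_eq_sum, mul_comm]
  have hneg : ∀ Γ Φ Γ' Φ' : PauliWord2 n,
      wordMat Γ.1 * wordMat Φ.1 = -(wordMat Γ'.1 * wordMat Φ'.1) →
        momentMatrix ψ Γ Φ = -momentMatrix ψ Γ' Φ' := by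
    intro Γ Φ Γ' Φ' h
    simp [momentMatrix, h, Matrix.neg_mulVec, neg_div]
  refine ⟨Matrix.IsSymm.ext fun Γ Φ => hsymm Φ Γ, ?_, fun Γ => ?_, fun Γ Φ h => ?_,
    fun Γ Φ Γ' Φ' h => ?_, hneg⟩
  · let A : Matrix (Fin n → Fin 2) (PauliWord2 n) ℝ :=
      Matrix.of fun f Γ => ((wordMat Γ.1 *ᵥ ψ) f).re
    let B : Matrix (Fin n → Fin 2) (PauliWord2 n) ℝ :=
      Matrix.of fun f Γ => ((wordMat Γ.1 *ᵥ ψ) f).im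
    have hAB : momentMatrix ψ = (star ψ ⬝ᵥ ψ).re⁻¹ • (Aᴴ * A + Bᴴ * B) := by
      ext Γ Φ
      simp [momentMatrix_apply_eq_sum, A, B, Matrix.mul_apply, div_eq_inv_mul]
    rw [hAB]
    exact ((Matrix.posSemidef_conjTranspose_mul_self A).add
      (Matrix.posSemidef_conjTranspose_mul_self B)).smul (inv_nonneg.2 hpos.le)
  · simp [momentMatrix, wordMat_mul_self, hpos.ne']
  · rcases wordMat_mul_comm_or Γ.1 Φ.1 with hc | hc
    · refine absurd ?_ h
      rw [Matrix.IsHermitian, Matrix.conjTranspose_mul, (wordMat_isHermitian _).eq,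
        (wordMat_isHermitian _).eq, hc]
    · have := hneg _ _ _ _ hc
      have := hsymm Γ Φ
      linarith
  · simp [momentMatrix, h]

theorem sum_pauli_mul_pauli (a b c d : Fin 2) :
    pauli 1 a b * pauli 1 c d + pauli 2 a b * pauli 2 c d + pauli 3 a b * pauli 3 c d =
      2 * (if a = d ∧ c = b then 1 else 0) - if a = b ∧ c = d then 1 else 0 := by
  fin_cases a <;> fin_cases b <;> fin_cases c <;> fin_cases d <;> simp [pauli] <;> norm_num

theorem wordMat_pairWord_apply {n : ℕ} (σ : Fin 4) {i j : Fin n} (hij : i ≠ j)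
    (f g : Fin n → Fin 2) : wordMat (pairWord σ i j).1 f g =
      pauli σ (f i) (g i) * pauli σ (f j) (g j) *
        if ∀ k, k ≠ i → k ≠ j → f k = g k then 1 else 0 := by
  have hj : j ∈ Finset.univ.erase i := Finset.mem_erase.2 ⟨hij.symm, Finset.mem_univ j⟩
  rw [wordMat, Matrix.of_apply, ← Finset.mul_prod_erase _ _ (Finset.mem_univ i),
    ← Finset.mul_prod_erase _ _ hj, ← mul_assoc]
  have h : ∀ k ∈ (Finset.univ.erase i).erase j,
      pauli ((pairWord σ i j).1 k) (f k) (g k) = if f k = g k then 1 else 0 := by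
    intro k hk
    simp only [Finset.mem_erase, Finset.mem_univ, and_true] at hk
    simp [pairWord, hk.1, hk.2, pauli_zero, Matrix.one_apply]
  rw [Finset.prod_congr rfl h, Finset.prod_ite_zero]
  simp only [pairWord, true_or, or_true, if_true, Finset.prod_const_one, Finset.mem_erase,
    Finset.mem_univ, and_true, and_imp]
  congr 2
  exact propext ⟨fun h k hi hj => h k hj hi, fun h k hj hi => h k hi hj⟩

/-- On a pair of qubits, `XX + YY + ZZ` is twice the swap operator minus the identity. -/
theorem sum_wordMat_pairWord_mulVec {n : ℕ} {i j : Fin n} (hij : i ≠ j)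
    (ψ : (Fin n → Fin 2) → ℂ) (f : Fin n → Fin 2) :
    ((wordMat (pairWord 1 i j).1 + wordMat (pairWord 2 i j).1 +
      wordMat (pairWord 3 i j).1) *ᵥ ψ) f = 2 * ψ (f ∘ Equiv.swap i j) - ψ f := by
  have h : ∀ g, (wordMat (pairWord 1 i j).1 + wordMat (pairWord 2 i j).1 +
      wordMat (pairWord 3 i j).1) f g =
      2 * (if f ∘ Equiv.swap i j = g then 1 else 0) - if f = g then 1 else 0 := by
    intro g
    have h₁ : f = g ↔ (f i = g i ∧ f j = g j) ∧ ∀ k, k ≠ i → k ≠ j → f k = g k := by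
      refine ⟨fun h => by simp [h], fun h => funext fun k => ?_⟩
      by_cases hi : k = i
      · exact hi ▸ h.1.1
      by_cases hj : k = j
      · exact hj ▸ h.1.2
      exact h.2 k hi hj
    have h₂ : f ∘ Equiv.swap i j = g ↔
        (f i = g j ∧ f j = g i) ∧ ∀ k, k ≠ i → k ≠ j → f k = g k := by
      refine ⟨?_, fun h => funext fun k => ?_⟩
      · rintro rfl
        simp +contextual [Equiv.swap_apply_of_ne_of_ne]
      by_cases hi : k = i
      · simpa [hi] using h.1.2
      by_cases hj : k = j
      · simpa [hj] using h.1.1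
      simpa [Equiv.swap_apply_of_ne_of_ne hi hj] using h.2 k hi hj
    simp only [Matrix.add_apply, wordMat_pairWord_apply _ hij, ← add_mul, sum_pauli_mul_pauli,
      h₁, h₂]
    by_cases hP : ∀ k, k ≠ i → k ≠ j → f k = g k
    · simp only [if_pos hP, and_iff_left hP, mul_one]
    · simp only [if_neg hP, if_neg fun h : _ ∧ _ => hP h.2]
      ring
  simp only [Matrix.mulVec, dotProduct, h, sub_mul, Finset.sum_sub_distrib, mul_assoc,
    ← Finset.mul_sum, ite_mul, one_mul, zero_mul, Finset.sum_ite_eq, Finset.mem_univ, if_true]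

/-- The unnormalized optimal state `n |1;0…0⟩ - ∑ⱼ |0;1ⱼ⟩` on the star. -/
noncomputable def starState (n : ℕ) (f : Fin (n + 1) → Fin 2) : ℂ :=
  ∑ k, (if k = 0 then (n : ℂ) else -1) * if f = Pi.single k 1 then 1 else 0

theorem starState_ne_zero {n : ℕ} (hn : 1 ≤ n) : starState n ≠ 0 := by
  intro h
  have h₀ := congrFun h (Pi.single 0 1)
  have hinj : ∀ k : Fin (n + 1), (Pi.single 0 1 : Fin (n + 1) → Fin 2) = Pi.single k 1 ↔ 0 = k := by
    intro k
    refine ⟨fun h => ?_, fun h => h ▸ rfl⟩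
    by_contra hk
    simpa [Pi.single_apply, hk] using congrFun h 0
  simp [starState, hinj] at h₀
  omega

theorem starState_comp_swap {n : ℕ} (i j : Fin (n + 1)) (f : Fin (n + 1) → Fin 2) :
    starState n (f ∘ Equiv.swap i j) =
      ∑ k, (if Equiv.swap i j k = 0 then (n : ℂ) else -1) * if f = Pi.single k 1 then 1 else 0 := by
  rw [starState, ← Equiv.sum_comp (Equiv.swap i j)]
  refine Finset.sum_congr rfl fun k _ => ?_
  congr 2
  refine propext ⟨fun h => ?_, fun h => ?_⟩
  · funext l
    have := congrFun h (Equiv.swap i j l)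
    simpa [Pi.single_apply] using this
  · funext l
    simp [h, Pi.single_apply, Equiv.swap_apply_eq_iff]

theorem sum_starState_sub_comp_swap {n : ℕ} (f : Fin (n + 1) → Fin 2) :
    ∑ j : Fin n, (starState n f - starState n (f ∘ Equiv.swap 0 j.succ)) =
      ((n : ℂ) + 1) * starState n f := by
  simp only [starState_comp_swap]
  simp only [starState, ← Finset.sum_sub_distrib, ← sub_mul]
  rw [Finset.sum_comm, Finset.mul_sum]
  refine Finset.sum_congr rfl fun k _ => ?_
  rw [← Finset.sum_mul, ← mul_assoc]
  congr 1
  have hswap : ∀ j : Fin n, Equiv.swap 0 j.succ k = 0 ↔ k = j.succ := fun j => by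
    rw [Equiv.swap_apply_eq_iff, Equiv.swap_apply_left]
  simp only [hswap]
  refine Fin.cases ?_ (fun l => ?_) k
  · simp [(Fin.succ_ne_zero _).symm]
    ring
  · rw [Finset.sum_eq_single l]
    · simp
      ring
    · intro j _ hj
      simp [hj.symm]
    · simp

theorem momentMatrix_pair {n : ℕ} (ψ : (Fin n → Fin 2) → ℂ) {i j : Fin n} (hij : i ≠ j) :
    momentMatrix ψ (pairWord 1 i j) (idWord n) + momentMatrix ψ (pairWord 2 i j) (idWord n) +
      momentMatrix ψ (pairWord 3 i j) (idWord n) =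
      (star ψ ⬝ᵥ fun f => 2 * ψ (f ∘ Equiv.swap i j) - ψ f).re / (star ψ ⬝ᵥ ψ).re := by
  simp only [momentMatrix, Matrix.of_apply, idWord, wordMat_zero, mul_one, ← add_div,
    ← Complex.add_re, ← dotProduct_add, ← Matrix.add_mulVec]
  congr 3
  funext f
  exact sum_wordMat_pairWord_mulVec hij ψ f

theorem momentMatrix_starState_value {n : ℕ} (hn : 1 ≤ n) :
    ∑ j : Fin n, (1 - (momentMatrix (starState n) (pairWord 1 0 j.succ) (idWord (n + 1)) +
      momentMatrix (starState n) (pairWord 2 0 j.succ) (idWord (n + 1)) +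
      momentMatrix (starState n) (pairWord 3 0 j.succ) (idWord (n + 1)))) =
      2 * ((n : ℝ) + 1) := by
  have hpos := dotProduct_star_self_re_pos (starState_ne_zero hn)
  set ψ := starState n with hψ
  simp only [momentMatrix_pair ψ (Fin.succ_ne_zero _).symm]
  have h : ∀ j : Fin n, 1 - (star ψ ⬝ᵥ fun f => 2 * ψ (f ∘ Equiv.swap 0 j.succ) - ψ f).re /
      (star ψ ⬝ᵥ ψ).re =
      (star ψ ⬝ᵥ fun f => 2 * (ψ f - ψ (f ∘ Equiv.swap 0 j.succ))).re / (star ψ ⬝ᵥ ψ).re := by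
    intro j
    rw [eq_div_iff hpos.ne', sub_mul, one_mul, div_mul_cancel₀ _ hpos.ne', ← Complex.sub_re,
      ← dotProduct_sub]
    congr 3
    funext f
    simp only [Pi.sub_apply]
    ring
  rw [Finset.sum_congr rfl fun j _ => h j, ← Finset.sum_div, ← Complex.re_sum,
    ← dotProduct_sum, div_eq_iff hpos.ne']
  have h' : (∑ j : Fin n, fun f => 2 * (ψ f - ψ (f ∘ Equiv.swap 0 j.succ))) =
      (2 * ((n : ℝ) + 1)) • ψ := by
    funext f
    rw [Finset.sum_apply, ← Finset.mul_sum, hψ, sum_starState_sub_comp_swap]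
    simp [mul_assoc]
  rw [h', dotProduct_smul, Complex.smul_re, smul_eq_mul]

end Attainment

/-- For the star graph with `n ≥ 1` leaves (vertex set `{0,…,n}`, edges `{0j}` for
`j = 1,…,n`) with unit weights, the optimal value of the Lasserre₂ relaxation of Quantum
Max Cut, i.e. the supremum over Lasserre₂-feasible matrices `M` of
`Σ_{j=1}^n (1 − M(X₀X_j, I) − M(Y₀Y_j, I) − M(Z₀Z_j, I))`, equals `2(n+1)`, and it is
attained. -/
theorem lasserre2_star_optimal (n : ℕ) (hn : 1 ≤ n) :
    IsGreatest {r : ℝ | ∃ M : Matrix (PauliWord2 (n + 1)) (PauliWord2 (n + 1)) ℝ,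
      Lasserre2Feasible M ∧
      r = ∑ j ∈ Finset.univ.erase (0 : Fin (n + 1)),
        (1 - M (pairWord 1 0 j) (idWord (n + 1)) - M (pairWord 2 0 j) (idWord (n + 1))
          - M (pairWord 3 0 j) (idWord (n + 1)))}
      (2 * ((n : ℝ) + 1)) := by
  have herase : ∀ F : Fin (n + 1) → ℝ, ∑ j ∈ Finset.univ.erase 0, F j = ∑ j : Fin n, F j.succ :=
    fun F => by
      rw [Finset.sum_erase_eq_sub (Finset.mem_univ _), Fin.sum_univ_succ, add_sub_cancel_left]
  simp only [herase, sub_sub]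
  refine ⟨⟨_, momentMatrix_feasible (starState_ne_zero hn),
    (momentMatrix_starState_value hn).symm⟩, ?_⟩
  rintro r ⟨M, hM, rfl⟩
  have h := hM.star_le
  simp only [pairSum, Fin.sum_univ_three] at h
  exact h
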